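/- Let C be an HF-category, D an E-category, and F : C → D an E-functor, with transports S(p, q)(f) := F(Hom_C(r(b), q)(id_b)) ∘ f ∘ F(Hom_C(p, r(a))(id_a)) on the hom-setoids Hom_D(F a, F b). Then for proofs p : a ≈ a', q : b ≈ b', r : c ≈ c' in the object setoid of C and g ∈ Hom_D(F a, F b), f ∈ Hom_D(F b, F c): S(q, r)(f) ∘ S(p, q)(g) ≈ S(p, r)(f ∘ g). -/

import Mathlib

/-- A hom-family presented category (HF-category): a setoid of objects, a
proof-irrelevant family of hom-setoids with transports, identities and an
extensional composition, together with coherence conditions for the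
transports. -/
structure HFCat where
  Ob : Type
  eqv : Ob → Ob → Prop
  eqvE : Equivalence eqv
  Hom : Ob → Ob → Type
  hrel : ∀ a b, Hom a b → Hom a b → Prop
  hrelE : ∀ a b, Equivalence (hrel a b)
  /-- transport `Hom(p, q) : Hom(a, b) → Hom(a', b')` -/
  tr : ∀ {a a' b b'}, eqv a a' → eqv b b' → Hom a b → Hom a' b'
  tr_ext : ∀ {a a' b b'} (p : eqv a a') (q : eqv b b') {f f' : Hom a b},
    hrel a b f f' → hrel a' b' (tr p q f) (tr p q f')
  /-- (F1) transport along reflexivity is the identity -/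
  tr_refl : ∀ {a b} (f : Hom a b), hrel a b (tr (eqvE.refl a) (eqvE.refl b) f) f
  /-- (F2) proof irrelevance of transport -/
  tr_irrel : ∀ {a a' b b'} (p p' : eqv a a') (q q' : eqv b b') (f : Hom a b),
    hrel a' b' (tr p q f) (tr p' q' f)
  /-- (F3) transports compose -/
  tr_trans : ∀ {a a' a'' b b' b''} (p : eqv a a') (p' : eqv a' a'')
    (q : eqv b b') (q' : eqv b' b'') (f : Hom a b),
    hrel a'' b'' (tr p' q' (tr p q f)) (tr (eqvE.trans p p') (eqvE.trans q q') f)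
  id : ∀ a, Hom a a
  comp : ∀ {a b c}, Hom b c → Hom a b → Hom a c
  comp_ext : ∀ {a b c} {g g' : Hom b c} {f f' : Hom a b},
    hrel b c g g' → hrel a b f f' → hrel a c (comp g f) (comp g' f')
  id_left : ∀ {a b} (f : Hom a b), hrel a b (comp (id b) f) f
  id_right : ∀ {a b} (f : Hom a b), hrel a b (comp f (id a)) f
  assoc : ∀ {a b c d} (f : Hom a b) (g : Hom b c) (h : Hom c d),
    hrel a d (comp h (comp g f)) (comp (comp h g) f)
  /-- coherence of identities with transport -/
  coh_id : ∀ {a a'} (p : eqv a a'), hrel a' a' (id a') (tr p p (id a))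
  /-- coherence of composition with transport -/
  coh_comp : ∀ {a a' b b' c c'} (p : eqv a a') (q : eqv b b') (r : eqv c c')
    (f : Hom a b) (g : Hom b c),
    hrel a' c' (comp (tr q r g) (tr p q f)) (tr p r (comp g f))

/-- An E-category: a type of objects, hom-setoids, identities and an
extensional composition satisfying unit and associativity laws. -/
structure ECat where
  Ob : Type
  Hom : Ob → Ob → Type
  hrel : ∀ a b, Hom a b → Hom a b → Prop
  hrelE : ∀ a b, Equivalence (hrel a b)
  id : ∀ a, Hom a a
  comp : ∀ {a b c}, Hom b c → Hom a b → Hom a c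
  comp_ext : ∀ {a b c} {g g' : Hom b c} {f f' : Hom a b},
    hrel b c g g' → hrel a b f f' → hrel a c (comp g f) (comp g' f')
  id_left : ∀ {a b} (f : Hom a b), hrel a b (comp (id b) f) f
  id_right : ∀ {a b} (f : Hom a b), hrel a b (comp f (id a)) f
  assoc : ∀ {a b c d} (f : Hom a b) (g : Hom b c) (h : Hom c d),
    hrel a d (comp h (comp g f)) (comp (comp h g) f)

/-- An E-functor from an HF-category `C` to an E-category `D`. -/
structure EFunctor (C : HFCat) (D : ECat) where
  obj : C.Ob → D.Ob
  map : ∀ {a b}, C.Hom a b → D.Hom (obj a) (obj b)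
  map_ext : ∀ {a b} {f f' : C.Hom a b}, C.hrel a b f f' →
    D.hrel (obj a) (obj b) (map f) (map f')
  map_id : ∀ a, D.hrel (obj a) (obj a) (map (C.id a)) (D.id (obj a))
  map_comp : ∀ {a b c} (g : C.Hom b c) (f : C.Hom a b),
    D.hrel (obj a) (obj c) (map (C.comp g f)) (D.comp (map g) (map f))

/-- The induced transport `S(p, q)` on the hom-setoids `Hom_D(F a, F b)` of the
full image: `S(p, q)(f) = F(Hom_C(r(b), q)(id_b)) ∘ f ∘ F(Hom_C(p, r(a))(id_a))`. -/
def Str {C : HFCat} {D : ECat} (F : EFunctor C D) {a a' b b' : C.Ob}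
    (p : C.eqv a a') (q : C.eqv b b') (f : D.Hom (F.obj a) (F.obj b)) :
    D.Hom (F.obj a') (F.obj b') :=
  D.comp (F.map (C.tr (C.eqvE.refl b) q (C.id b)))
    (D.comp f (F.map (C.tr p (C.eqvE.refl a) (C.id a))))

/-- The two transports of an identity along an equality of objects are mutually inverse. -/
theorem HFCat.comp_tr_id (C : HFCat) {b b' : C.Ob} (q : C.eqv b b') :
    C.hrel b b (C.comp (C.tr q (C.eqvE.refl b) (C.id b)) (C.tr (C.eqvE.refl b) q (C.id b)))
      (C.id b) :=
  (C.hrelE b b).trans (C.coh_comp (C.eqvE.refl b) q (C.eqvE.refl b) (C.id b) (C.id b))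
    ((C.hrelE b b).trans (C.tr_refl _) (C.id_left _))

/-- An inverse pair in the middle of a composite cancels. -/
theorem ECat.comp_cancel_middle (D : ECat) {u v w x y z : D.Ob} (k : D.Hom y z)
    (f : D.Hom w y) (s : D.Hom x w) (t : D.Hom w x) (g : D.Hom v w) (h : D.Hom u v)
    (hst : D.hrel w w (D.comp s t) (D.id w)) :
    D.hrel u z (D.comp (D.comp k (D.comp f s)) (D.comp t (D.comp g h)))
      (D.comp k (D.comp (D.comp f g) h)) := by
  have hcancel : D.hrel u w (D.comp s (D.comp t (D.comp g h))) (D.comp g h) :=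
    (D.hrelE _ _).trans (D.assoc _ _ _)
      ((D.hrelE _ _).trans (D.comp_ext hst ((D.hrelE _ _).refl _)) (D.id_left _))
  refine (D.hrelE _ _).trans ((D.hrelE _ _).symm (D.assoc _ _ _))
    (D.comp_ext ((D.hrelE _ _).refl _) ?_)
  exact (D.hrelE _ _).trans ((D.hrelE _ _).symm (D.assoc _ _ _))
    ((D.hrelE _ _).trans (D.comp_ext ((D.hrelE _ _).refl _) hcancel) (D.assoc _ _ _))

/-- Coherence of composition in the full image:
`S(q, r)(f) ∘ S(p, q)(g) ≈ S(p, r)(f ∘ g)`. -/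
theorem fullImage_coh_comp (C : HFCat) (D : ECat) (F : EFunctor C D)
    {a a' b b' c c' : C.Ob} (p : C.eqv a a') (q : C.eqv b b') (r : C.eqv c c')
    (g : D.Hom (F.obj a) (F.obj b)) (f : D.Hom (F.obj b) (F.obj c)) :
    D.hrel (F.obj a') (F.obj c')
      (D.comp (Str F q r f) (Str F p q g))
      (Str F p r (D.comp f g)) := by
  refine D.comp_cancel_middle _ f _ _ g _ ?_
  exact (D.hrelE _ _).trans ((D.hrelE _ _).symm (F.map_comp _ _))
    ((D.hrelE _ _).trans (F.map_ext (C.comp_tr_id q)) (F.map_id b))
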